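/- arXiv:1809.08742 — 2 statements merged into one kernel-verified Lean document; each statement's English description precedes it below -/
import Mathlib

section
/- Let X be a semi-inner product space, let M,N ∈ ℝ^{2×2} be symmetric, and suppose M + N ⪯ −ηI for some η > 0. Let G and Φ be relations on X such that G satisfies the N-sector constraint and Φ satisfies the M-sector constraint. Let r be the spectral norm of the matrix [[N₁₂, M₁₁],[N₂₂, M₂₁]] and q the spectral norm of [[N₂₂, 0],[0, M₁₁]]. Then every ((u₁,u₂),(y₁,y₂)) ∈ R_uy satisfies ‖(y₁,y₂)‖ ≤ (1/η)(r + √(r² + ηq)) · ‖(u₁,u₂)‖. -/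
/-- A semi-inner product on a real vector space: a symmetric bilinear form
with nonnegative diagonal. -/
structure SIP (X : Type*) [AddCommGroup X] [Module ℝ X] where
  ip : X → X → ℝ
  symm : ∀ x y, ip x y = ip y x
  add_left : ∀ x y z, ip (x + y) z = ip x z + ip y z
  smul_left : ∀ (a : ℝ) (x y : X), ip (a • x) y = a * ip x y
  nonneg : ∀ x, 0 ≤ ip x x

variable {X : Type*} [AddCommGroup X] [Module ℝ X]

/-- Quadratic form `Q_P(ξ₁,ξ₂) = P₁₁⟨ξ₁,ξ₁⟩ + 2P₁₂⟨ξ₁,ξ₂⟩ + P₂₂⟨ξ₂,ξ₂⟩`. -/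
def SIP.Q (s : SIP X) (P : Matrix (Fin 2) (Fin 2) ℝ) (ξ₁ ξ₂ : X) : ℝ :=
  P 0 0 * s.ip ξ₁ ξ₁ + 2 * P 0 1 * s.ip ξ₁ ξ₂ + P 1 1 * s.ip ξ₂ ξ₂

/-- Semi-norm of a pair: `‖(a,b)‖ = √(⟨a,a⟩ + ⟨b,b⟩)`. -/
noncomputable def SIP.pairNorm (s : SIP X) (p : X × X) : ℝ :=
  Real.sqrt (s.ip p.1 p.1 + s.ip p.2 p.2)

/-- `(u₁,u₂,e₁,e₂,y₁,y₂)` solves the interconnection of `G` and `Φ`. -/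
def Solves (G Φ : Set (X × X)) (u₁ u₂ e₁ e₂ y₁ y₂ : X) : Prop :=
  e₁ = u₁ + y₂ ∧ (e₂, y₂) ∈ Φ ∧ e₂ = u₂ + y₁ ∧ (e₁, y₁) ∈ G

/-- The closed-loop relation from inputs `(u₁,u₂)` to outputs `(y₁,y₂)`. -/
def Ruy (G Φ : Set (X × X)) : Set ((X × X) × (X × X)) :=
  {p | ∃ e₁ e₂ : X, Solves G Φ p.1.1 p.1.2 e₁ e₂ p.2.1 p.2.2}

/-- The closed-loop relation from inputs `(u₁,u₂)` to errors `(e₁,e₂)`. -/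
def Rue (G Φ : Set (X × X)) : Set ((X × X) × (X × X)) :=
  {p | ∃ y₁ y₂ : X, Solves G Φ p.1.1 p.1.2 p.2.1 p.2.2 y₁ y₂}

/-- A set of relations is complete if every pair is contained in some member. -/
def RelComplete (C : Set (Set (X × X))) : Prop :=
  ∀ x y : X, ∃ Φ ∈ C, (x, y) ∈ Φ

/-- Component of a pair, indexed by `Fin 2`. -/
def pcomp (p : X × X) (i : Fin 2) : X := if i = 0 then p.1 else p.2

/-- A set of relations is feedback-invariant if every partial closed-loop map
of members is again a member. -/
def FeedbackInvariant (C : Set (Set (X × X))) : Prop :=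
  ∀ G ∈ C, ∀ Φ ∈ C, ∀ i j : Fin 2,
    {q : X × X | ∃ p ∈ Ruy G Φ, q.1 = pcomp p.1 i ∧ q.2 = pcomp p.2 j} ∈ C

/-- Spectral norm of a real 2×2 matrix. -/
noncomputable def specNorm (A : Matrix (Fin 2) (Fin 2) ℝ) : ℝ :=
  ‖LinearMap.toContinuousLinearMap (Matrix.toEuclideanLin A)‖

namespace SIP

lemma add_right (s : SIP X) (x y z : X) : s.ip x (y + z) = s.ip x y + s.ip x z := by
  rw [s.symm, s.add_left, s.symm y, s.symm z]

lemma smul_right (s : SIP X) (a : ℝ) (x y : X) : s.ip x (a • y) = a * s.ip x y := by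
  rw [s.symm, s.smul_left, s.symm]

/-- Cauchy–Schwarz inequality for a semi-inner product. -/
lemma ip_sq_le (s : SIP X) (x y : X) : s.ip x y ^ 2 ≤ s.ip x x * s.ip y y := by
  have h : ∀ t : ℝ, 0 ≤ s.ip y y * (t * t) + 2 * s.ip x y * t + s.ip x x := fun t => by
    have := s.nonneg (x + t • y)
    simp only [s.add_left, s.add_right, s.smul_left, s.smul_right, s.symm y x] at this
    linarith
  have := discrim_le_zero h
  unfold discrim at this
  nlinarith

/-- The sum semi-inner product on pairs. -/
def prod (s : SIP X) : SIP (X × X) where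
  ip p q := s.ip p.1 q.1 + s.ip p.2 q.2
  symm p q := by rw [s.symm p.1, s.symm p.2]
  add_left p q r := by simp only [Prod.fst_add, Prod.snd_add, s.add_left]; ring
  smul_left a p q := by simp only [Prod.smul_fst, Prod.smul_snd, s.smul_left]; ring
  nonneg p := add_nonneg (s.nonneg _) (s.nonneg _)

lemma pairNorm_nonneg (s : SIP X) (p : X × X) : 0 ≤ s.pairNorm p := Real.sqrt_nonneg _

lemma pairNorm_sq (s : SIP X) (p : X × X) :
    s.pairNorm p ^ 2 = s.ip p.1 p.1 + s.ip p.2 p.2 :=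
  Real.sq_sqrt (s.prod.nonneg p)

lemma prod_ip_le (s : SIP X) (p q : X × X) :
    s.ip p.1 q.1 + s.ip p.2 q.2 ≤ s.pairNorm p * s.pairNorm q := by
  refine abs_le_of_sq_le_sq' ?_ (mul_nonneg (s.pairNorm_nonneg p) (s.pairNorm_nonneg q)) |>.2
  rw [mul_pow, pairNorm_sq, pairNorm_sq]
  exact s.prod.ip_sq_le p q

/-- A nonnegative real binary quadratic form stays nonnegative on a semi-inner product space. -/
lemma quadForm_nonneg (s : SIP X) {a b c : ℝ}
    (h : ∀ t u : ℝ, 0 ≤ a * t ^ 2 + 2 * b * (t * u) + c * u ^ 2) (x y : X) :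
    0 ≤ a * s.ip x x + 2 * b * s.ip x y + c * s.ip y y := by
  have hx := Real.sq_sqrt (s.nonneg x)
  have hy := Real.sq_sqrt (s.nonneg y)
  have hxy : |s.ip x y| ≤ √(s.ip x x) * √(s.ip y y) := by
    refine abs_le_of_sq_le_sq ?_ (by positivity)
    rw [mul_pow, hx, hy]
    exact s.ip_sq_le x y
  obtain ⟨h₁, h₂⟩ := abs_le.mp hxy
  have h₃ := h √(s.ip x x) √(s.ip y y)
  have h₄ := h √(s.ip x x) (-√(s.ip y y))
  rw [neg_sq, hx, hy] at h₄
  rw [hx, hy] at h₃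
  rcases le_total 0 b with hb | hb <;> nlinarith

end SIP

lemma specNorm_nonneg (A : Matrix (Fin 2) (Fin 2) ℝ) : 0 ≤ specNorm A := norm_nonneg _

lemma sq_add_sq_le_specNorm_sq (A : Matrix (Fin 2) (Fin 2) ℝ) (t u : ℝ) :
    (A 0 0 * t + A 0 1 * u) ^ 2 + (A 1 0 * t + A 1 1 * u) ^ 2 ≤
      specNorm A ^ 2 * (t ^ 2 + u ^ 2) := by
  have h := (LinearMap.toContinuousLinearMap (Matrix.toEuclideanLin A)).le_opNorm !₂[t, u]
  have h' := pow_le_pow_left₀ (norm_nonneg _) h 2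
  rw [mul_pow, EuclideanSpace.norm_sq_eq, EuclideanSpace.norm_sq_eq] at h'
  simpa [Matrix.toLpLin_apply, Matrix.mulVec, dotProduct, Fin.sum_univ_two, specNorm] using h'

/-- A real matrix acts on pairs of vectors with gain at most its spectral norm. -/
lemma SIP.bilin_le (s : SIP X) (A : Matrix (Fin 2) (Fin 2) ℝ) (u y : X × X) :
    A 0 0 * s.ip y.1 u.1 + A 0 1 * s.ip y.1 u.2 + A 1 0 * s.ip y.2 u.1 + A 1 1 * s.ip y.2 u.2 ≤
      specNorm A * s.pairNorm y * s.pairNorm u := by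
  let v : X × X := (A 0 0 • u.1 + A 0 1 • u.2, A 1 0 • u.1 + A 1 1 • u.2)
  have hv : s.pairNorm v ≤ specNorm A * s.pairNorm u := by
    refine abs_le_of_sq_le_sq' ?_ (mul_nonneg (specNorm_nonneg A) (s.pairNorm_nonneg u)) |>.2
    rw [mul_pow, s.pairNorm_sq, s.pairNorm_sq]
    have := s.quadForm_nonneg (a := specNorm A ^ 2 - A 0 0 ^ 2 - A 1 0 ^ 2)
      (b := -(A 0 0 * A 0 1 + A 1 0 * A 1 1)) (c := specNorm A ^ 2 - A 0 1 ^ 2 - A 1 1 ^ 2)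
      (fun t w => by linarith [sq_add_sq_le_specNorm_sq A t w]) u.1 u.2
    simp only [v, s.add_left, s.add_right, s.smul_left, s.smul_right, s.symm u.2 u.1]
    linarith
  have h := s.prod_ip_le y v
  have h' := mul_le_mul_of_nonneg_left hv (s.pairNorm_nonneg y)
  simp only [v, s.add_right, s.smul_right] at h h'
  linarith

lemma le_specNorm_diagonal (a b : ℝ) :
    a ≤ specNorm !![a, 0; 0, b] ∧ b ≤ specNorm !![a, 0; 0, b] := by
  have h₁ := sq_add_sq_le_specNorm_sq !![a, 0; 0, b] 1 0
  have h₂ := sq_add_sq_le_specNorm_sq !![a, 0; 0, b] 0 1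
  simp at h₁ h₂
  have h₀ := specNorm_nonneg !![a, 0; 0, b]
  exact ⟨(abs_le_of_sq_le_sq' h₁ h₀).2, (abs_le_of_sq_le_sq' h₂ h₀).2⟩

lemma le_of_quadratic_le {η r q Y U : ℝ} (hη : 0 < η) (hq : 0 ≤ q)
    (hU : 0 ≤ U) (h : η * Y ^ 2 ≤ 2 * (r * Y * U) + q * U ^ 2) :
    Y ≤ 1 / η * (r + √(r ^ 2 + η * q)) * U := by
  have hd : 0 ≤ r ^ 2 + η * q := by positivity
  have hs := Real.sq_sqrt hd
  have key : η * Y - r * U ≤ √(r ^ 2 + η * q) * U := by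
    refine abs_le_of_sq_le_sq' ?_ (by positivity) |>.2
    rw [mul_pow, hs]
    nlinarith
  rw [one_div, mul_assoc, ← div_eq_inv_mul, le_div_iff₀ hη]
  linarith

/-- sufficiency part with explicit gain: if `M + N ⪯ -ηI`,
`G` satisfies the `N`-sector constraint and `Φ` the `M`-sector constraint,
then every `(u,y) ∈ R_uy` satisfies
`‖y‖ ≤ (1/η)(r + √(r² + ηq))‖u‖`. -/
theorem sufficiency_explicit_gain (s : SIP X)
    (M N : Matrix (Fin 2) (Fin 2) ℝ) (hM : M.IsSymm) (hN : N.IsSymm)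
    (η : ℝ) (hη : 0 < η)
    (hMN : (-(η • (1 : Matrix (Fin 2) (Fin 2) ℝ)) - (M + N)).PosSemidef)
    (G Φ : Set (X × X))
    (hG : ∀ ξ ζ : X, (ξ, ζ) ∈ G → 0 ≤ s.Q N ζ ξ)
    (hΦ : ∀ ξ ζ : X, (ξ, ζ) ∈ Φ → 0 ≤ s.Q M ξ ζ) :
    ∀ u y : X × X, (u, y) ∈ Ruy G Φ →
      s.pairNorm y ≤
        (1 / η) * (specNorm !![N 0 1, M 0 0; N 1 1, M 1 0] +
          Real.sqrt ((specNorm !![N 0 1, M 0 0; N 1 1, M 1 0]) ^ 2 +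
            η * specNorm !![N 1 1, 0; 0, M 0 0])) * s.pairNorm u := by
  rintro ⟨u₁, u₂⟩ ⟨y₁, y₂⟩ ⟨_, _, rfl, h₂, rfl, h₁⟩
  have hg := hG _ _ h₁
  have hf := hΦ _ _ h₂
  have hM' : M 1 0 = M 0 1 := hM.apply 0 1
  have hN' : N 1 0 = N 0 1 := hN.apply 0 1
  have hneg := s.quadForm_nonneg (a := -η - (M 0 0 + N 0 0)) (b := -(M 0 1 + N 0 1))
    (c := -η - (M 1 1 + N 1 1)) (fun t w => by
      have := hMN.dotProduct_mulVec_nonneg ![t, w]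
      simp [Matrix.mulVec, dotProduct, Fin.sum_univ_two, hM', hN'] at this
      linarith) y₁ y₂
  have hcross := s.bilin_le !![N 0 1, M 0 0; N 1 1, M 1 0] (u₁, u₂) (y₁, y₂)
  obtain ⟨hq₁, hq₂⟩ := le_specNorm_diagonal (N 1 1) (M 0 0)
  refine le_of_quadratic_le hη (specNorm_nonneg _) (s.pairNorm_nonneg _) ?_
  rw [s.pairNorm_sq (y₁, y₂), s.pairNorm_sq (u₁, u₂)]
  have hq₁' := mul_le_mul_of_nonneg_right hq₁ (s.nonneg u₁)
  have hq₂' := mul_le_mul_of_nonneg_right hq₂ (s.nonneg u₂)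
  simp only [SIP.Q, s.add_left, s.add_right, s.symm u₂ y₁,
    s.symm u₁ y₂, s.symm u₂ y₂] at hg hf
  simp only [Matrix.of_apply, Matrix.cons_val', Matrix.cons_val_zero, Matrix.cons_val_one,
    Matrix.cons_val_fin_one, hM'] at hcross ⊢
  linarith
end

section
/- Let V be a real vector space, let S ⊆ V be a linear subspace, and let σ₀ and σ₁ be quadratic forms on V. Assume there exists x̄ ∈ S with σ₁(x̄) > 0. Then the following are equivalent: (S1) for all x ∈ S, σ₁(x) ≥ 0 implies σ₀(x) ≤ 0; (S2) there exists τ ≥ 0 such that σ₀(x) + τσ₁(x) ≤ 0 for all x ∈ S. -/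
/-- A quadratic form on a real vector space: a function arising as the diagonal
of a symmetric bilinear form. -/
def IsQuadraticForm {V : Type*} [AddCommGroup V] [Module ℝ V] (Q : V → ℝ) : Prop :=
  ∃ B : V →ₗ[ℝ] V →ₗ[ℝ] ℝ, (∀ x y : V, B x y = B y x) ∧ ∀ x : V, Q x = B x x

/-- If `A t² + 2 B t + C` is nonpositive wherever `a t² + 2 b t + c` is nonnegative, with `c < 0 < a`,
then `C a ≤ A c`. -/
lemma mul_le_mul_of_quadratic_implication {a b c A B C : ℝ} (ha : 0 < a) (hc : c < 0)
    (h : ∀ t : ℝ, 0 ≤ a * t ^ 2 + 2 * b * t + c → A * t ^ 2 + 2 * B * t + C ≤ 0) :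
    C * a ≤ A * c := by
  have hac : a * c < 0 := mul_neg_of_pos_of_neg ha hc
  set s := √(b ^ 2 - a * c)
  have hs : s ^ 2 = b ^ 2 - a * c := Real.sq_sqrt (by nlinarith [sq_nonneg b])
  have hbs : |b| < s := by
    rw [← Real.sqrt_sq_eq_abs]
    exact Real.sqrt_lt_sqrt (sq_nonneg b) (by linarith)
  obtain ⟨hbs₁, hbs₂⟩ := abs_lt.mp hbs
  have root (r : ℝ) (hr : r ^ 2 + 2 * b * r + a * c = 0) :
      A * r ^ 2 + 2 * B * a * r + C * a ^ 2 ≤ 0 := by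
    have h₁ : a * (r / a) ^ 2 + 2 * b * (r / a) + c = (r ^ 2 + 2 * b * r + a * c) / a := by
      field_simp
    have h₂ : A * r ^ 2 + 2 * B * a * r + C * a ^ 2 =
        a ^ 2 * (A * (r / a) ^ 2 + 2 * B * (r / a) + C) := by
      field_simp
    rw [h₂]
    exact mul_nonpos_of_nonneg_of_nonpos (sq_nonneg a) (h _ (by rw [h₁, hr, zero_div]))
  have hneg := root (-b - s) (by linear_combination hs)
  have hpos := root (-b + s) (by linear_combination hs)
  -- The positive weights `s - b` and `s + b` cancel the linear terms.
  have hcomb : 2 * s * a * (C * a - A * c) ≤ 0 := by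
    calc 2 * s * a * (C * a - A * c)
        = (s - b) * (A * (-b - s) ^ 2 + 2 * B * a * (-b - s) + C * a ^ 2) +
          (s + b) * (A * (-b + s) ^ 2 + 2 * B * a * (-b + s) + C * a ^ 2) := by
          linear_combination (-2 * s * A) * hs
      _ ≤ 0 := add_nonpos
          (mul_nonpos_of_nonneg_of_nonpos (by linarith) hneg)
          (mul_nonpos_of_nonneg_of_nonpos (by linarith) hpos)
  have hsa : 0 < 2 * s * a := by
    have : 0 < s := (abs_nonneg b).trans_lt hbs
    positivity
  exact sub_nonpos.mp (nonpos_of_mul_nonpos_right hcomb hsa)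

/-- Expansion of a quadratic form along a line. -/
lemma IsQuadraticForm.exists_add_smul {V : Type*} [AddCommGroup V] [Module ℝ V] {Q : V → ℝ}
    (hQ : IsQuadraticForm Q) (u v : V) :
    ∃ b : ℝ, ∀ t : ℝ, Q (v + t • u) = Q u * t ^ 2 + 2 * b * t + Q v := by
  obtain ⟨B, hsymm, hB⟩ := hQ
  refine ⟨B u v, fun t => ?_⟩
  simp only [hB, map_add, map_smul, LinearMap.add_apply, LinearMap.smul_apply, smul_eq_mul,
    hsymm v u]
  ring

/-- S-lemma on a subspace of a real vector space, with Slater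
condition: for quadratic forms `σ₀, σ₁` on `V` and a subspace `S` containing a
point where `σ₁` is strictly positive, implication of the quadratic inequalities
is equivalent to the existence of a nonnegative multiplier `τ`. -/
theorem s_lemma {V : Type*} [AddCommGroup V] [Module ℝ V]
    (S : Submodule ℝ V) (σ₀ σ₁ : V → ℝ)
    (h₀ : IsQuadraticForm σ₀) (h₁ : IsQuadraticForm σ₁)
    (hslater : ∃ x ∈ S, 0 < σ₁ x) :
    (∀ x ∈ S, 0 ≤ σ₁ x → σ₀ x ≤ 0) ↔
      (∃ τ : ℝ, 0 ≤ τ ∧ ∀ x ∈ S, σ₀ x + τ * σ₁ x ≤ 0) := by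
  constructor
  · intro h
    have key {u v : V} (hu : u ∈ S) (hv : v ∈ S) (hu₁ : 0 < σ₁ u) (hv₁ : σ₁ v < 0) :
        σ₀ v * σ₁ u ≤ σ₀ u * σ₁ v := by
      obtain ⟨b₀, hb₀⟩ := h₀.exists_add_smul u v
      obtain ⟨b₁, hb₁⟩ := h₁.exists_add_smul u v
      refine mul_le_mul_of_quadratic_implication (b := b₁) (B := b₀) hu₁ hv₁ fun t ht => ?_
      rw [← hb₀]
      exact h _ (S.add_mem hv (S.smul_mem t hu)) (by rwa [hb₁])
    -- The multiplier is the largest one compatible with the points where `σ₁` is positive.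
    let U : Set ℝ := (fun u => -σ₀ u / σ₁ u) '' {u | u ∈ S ∧ 0 < σ₁ u}
    have hU : U.Nonempty := Set.Nonempty.image _ hslater
    have hU₀ : ∀ r ∈ U, 0 ≤ r := by
      rintro _ ⟨u, ⟨hu, hu₁⟩, rfl⟩
      exact div_nonneg (neg_nonneg.mpr (h u hu hu₁.le)) hu₁.le
    refine ⟨sInf U, le_csInf hU hU₀, fun x hx => ?_⟩
    rcases lt_trichotomy (σ₁ x) 0 with hneg | hzero | hpos
    · have hle : σ₀ x / -σ₁ x ≤ sInf U := by
        refine le_csInf hU ?_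
        rintro _ ⟨u, ⟨hu, hu₁⟩, rfl⟩
        rw [div_le_div_iff₀ (neg_pos.mpr hneg) hu₁, neg_mul_neg]
        exact key hu hx hu₁ hneg
      rw [div_le_iff₀ (neg_pos.mpr hneg)] at hle
      linarith
    · simpa [hzero] using h x hx hzero.ge
    · have hle : sInf U ≤ -σ₀ x / σ₁ x := csInf_le ⟨0, hU₀⟩ ⟨x, ⟨hx, hpos⟩, rfl⟩
      rw [le_div_iff₀ hpos] at hle
      linarith
  · rintro ⟨τ, hτ, h⟩ x hx hx₁
    linarith [h x hx, mul_nonneg hτ hx₁]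
end
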